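/- arXiv:1803.10370 — 2 statements merged into one kernel-verified Lean document; each statement's English description precedes it below -/
import Mathlib

section
/- Let μ be a Borel probability measure on a compact interval 𝕀 ⊂ ℝ of positive length, and n ∈ ℕ. There exists a best Lévy-distance approximation of μ among probability measures supported on at most n points, and its distance to μ equals ω · L_•^{•,n}, where L_•^{•,n} = min{ a ≥ 0 : T_{F_μ,a}^{[n]}(0) ≥ 1 }. Moreover, for every x ∈ Ξ_n and p ∈ Π_n the following are equivalent: (i) d_L(μ, δ_x^p) = min_{y∈Ξ_n, q∈Π_n} d_L(μ, δ_y^q); (ii) for every j = 0,…,n with x_j < x_{j+1}, ℓ_{F_μ,[x_j,x_{j+1}]}(P_j) ≤ L_•^{•,n}; (iii) for every j = 1,…,n with P_{j−1} < P_j, ℓ_{F_μ⁻¹,[P_{j−1},P_j]}(x_j) ≤ L_•^{•,n}. -/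
open MeasureTheory Filter Set

noncomputable section

namespace BenfordApprox

/-- Right-hand limit `f₊` of a nondecreasing `f : ℝ → ℝ̄`, at an extended-real point. -/
def fplus (f : ℝ → EReal) (a : EReal) : EReal := sInf (f '' {x : ℝ | a < (x : EReal)})

/-- Left-hand limit `f₋` of a nondecreasing `f : ℝ → ℝ̄`, at an extended-real point. -/
def fminus (f : ℝ → EReal) (a : EReal) : EReal := sSup (f '' {x : ℝ | (x : EReal) < a})

/-- The (upper) inverse function `f⁻¹(t) = sup {x : f x ≤ t}` (with `sup ∅ = ⊥`). -/
def upperInv (f : ℝ → EReal) (t : ℝ) : EReal :=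
  sSup ((fun x : ℝ => (x : EReal)) '' {x : ℝ | f x ≤ (t : EReal)})

/-- The upper inverse, for an extended-real argument. -/
def upperInvE (f : ℝ → EReal) (t : EReal) : EReal :=
  sSup ((fun x : ℝ => (x : EReal)) '' {x : ℝ | f x ≤ t})

/-- Lévy-type distance `d_L(f,g)` between nondecreasing functions `f g : ℝ → ℝ̄`. -/
def dLfun (f g : ℝ → EReal) : EReal :=
  sInf ((fun y : ℝ => (y : EReal)) ''
    {y : ℝ | 0 ≤ y ∧ ∀ x : ℝ, f (x - y) - (y : EReal) ≤ g x ∧ g x ≤ f (x + y) + (y : EReal)})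

/-- The auxiliary function `ℓ_{f,I}`; it depends on `I` only through `lo = inf I`, `hi = sup I`. -/
def ell (f : ℝ → EReal) (lo hi : EReal) (x : ℝ) : ℝ :=
  sInf {y : ℝ | 0 ≤ y ∧ fminus f (hi - (y : EReal)) - (y : EReal) ≤ (x : EReal) ∧
    (x : EReal) ≤ fplus f (lo + (y : EReal)) + (y : EReal)}

/-- The minimal value `ℓ*_{f,I} = min {y ≥ 0 : f₋(sup I − y) − y ≤ f₊(inf I + y) + y}`. -/
def ellStar (f : ℝ → EReal) (lo hi : EReal) : ℝ :=
  sInf {y : ℝ | 0 ≤ y ∧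
    fminus f (hi - (y : EReal)) - (y : EReal) ≤ fplus f (lo + (y : EReal)) + (y : EReal)}

/-- Distribution function `F_μ(t) = μ {y ∈ 𝕀 : y ≤ t}` of `μ`, where `𝕀 = [A,B]`. -/
def cdf (μ : Measure ℝ) (A B : ℝ) (t : ℝ) : ℝ := (μ (Icc A B ∩ Iic t)).toReal

/-- `F_μ` evaluated at an extended-real point (so `F_μ(−∞) = 0`, `F_μ(+∞) = 1`). -/
def cdfE (μ : Measure ℝ) (A B : ℝ) (a : EReal) : ℝ :=
  (μ (Icc A B ∩ {y : ℝ | (y : EReal) ≤ a})).toReal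

/-- Left limit `F_{μ−}` at an extended-real point (so `F_{μ−}(−∞) = 0`, `F_{μ−}(+∞) = 1`). -/
def cdfL (μ : Measure ℝ) (A B : ℝ) (a : EReal) : ℝ :=
  sSup ((cdf μ A B) '' {t : ℝ | (t : EReal) < a})

/-- Left limit `F_{μ−}` at a real point. -/
def cdfm (μ : Measure ℝ) (A B : ℝ) (t : ℝ) : ℝ := sSup ((cdf μ A B) '' Iio t)

/-- The (upper) quantile function `F_μ⁻¹` of `μ` on `𝕀 = [A,B]`, extended monotonically to `ℝ`. -/
def quant (μ : Measure ℝ) (A B : ℝ) (t : ℝ) : ℝ :=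
  if t < (μ {A}).toReal ∨ t < 0 then A
  else sSup {y ∈ Icc A B | cdf μ A B y ≤ t}

/-- Left limit `F⁻¹_{μ−}` of the quantile function. -/
def quantm (μ : Measure ℝ) (A B : ℝ) (t : ℝ) : ℝ := sSup ((quant μ A B) '' Iio t)

/-- `F_μ` as a function into the extended reals. -/
def cdfEReal (μ : Measure ℝ) (A B : ℝ) : ℝ → EReal := fun t => ((cdf μ A B t : ℝ) : EReal)

/-- `F_μ⁻¹` as a function into the extended reals. -/
def quantEReal (μ : Measure ℝ) (A B : ℝ) : ℝ → EReal := fun t => ((quant μ A B t : ℝ) : EReal)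

/-- The finitely supported measure `δ_x^p = Σ_j p_j δ_{x_j}`. -/
def discr (n : ℕ) (x p : Fin n → ℝ) : Measure ℝ :=
  ∑ j : Fin n, ENNReal.ofReal (p j) • Measure.dirac (x j)

/-- `p ∈ Π_n`: a probability vector. -/
def IsPi (n : ℕ) (p : Fin n → ℝ) : Prop := (∀ j, 0 ≤ p j) ∧ ∑ j, p j = 1

/-- `x ∈ Ξ_n`: a nondecreasing vector of locations in `𝕀 = [A,B]`. -/
def IsXi (A B : ℝ) (n : ℕ) (x : Fin n → ℝ) : Prop := (∀ j, x j ∈ Icc A B) ∧ Monotone x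

/-- The uniform weight vector `u_n = (1/n, …, 1/n)`. -/
def unif (n : ℕ) : Fin n → ℝ := fun _ => 1 / (n : ℝ)

/-- Partial sums `P_i = Σ_{j<i} p_j` (so `P_0 = 0`, `P_n = 1`). -/
def psum (n : ℕ) (p : Fin n → ℝ) (i : ℕ) : ℝ := ∑ j : Fin n, if (j : ℕ) < i then p j else 0

/-- Locations extended by `x_0 = −∞`, `x_{n+1} = +∞`; here `extPts n x j` is the paper's `x_j`. -/
def extPts (n : ℕ) (x : Fin n → ℝ) : ℕ → EReal := fun j =>
  if hj : j = 0 then ⊥ else if h : j ≤ n then ((x ⟨j - 1, by omega⟩ : ℝ) : EReal) else ⊤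

/-- `xcoord n x j` is the paper's `x_{j+1}` (0-based access). -/
def xcoord (n : ℕ) (x : Fin n → ℝ) (j : ℕ) : ℝ := if h : j < n then x ⟨j, h⟩ else 0

/-- The normalizing constant `ω = max{1, λ(𝕀)}/λ(𝕀)` for `𝕀 = [A,B]`. -/
def omegaI (A B : ℝ) : ℝ := max 1 (B - A) / (B - A)

/-- Lévy distance between Borel measures on `𝕀 = [A,B]`. -/
def dLevy (A B : ℝ) (μ ν : Measure ℝ) : ℝ :=
  omegaI A B * sInf {y : ℝ | 0 ≤ y ∧
    ∀ t : ℝ, cdf μ A B (t - y) - y ≤ cdf ν A B t ∧ cdf ν A B t ≤ cdf μ A B (t + y) + y}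

/-- Kolmogorov (uniform) distance between Borel measures on `𝕀 = [A,B]`. -/
def dKol (A B : ℝ) (μ ν : Measure ℝ) : ℝ :=
  sSup (Set.range fun t : ℝ => |cdf μ A B t - cdf ν A B t|)

/-- `L¹`-Kantorovich distance between Borel measures on `𝕀 = [A,B]`. -/
def dKant1 (A B : ℝ) (μ ν : Measure ℝ) : ℝ :=
  (B - A)⁻¹ * ∫ y in Ioo (0 : ℝ) 1, |quant μ A B y - quant ν A B y|

/-- `L^r`-Kantorovich distance between Borel measures on `𝕀 = [A,B]`. -/
def dKant (A B r : ℝ) (μ ν : Measure ℝ) : ℝ :=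
  (B - A)⁻¹ * (∫ y in Ioo (0 : ℝ) 1, |quant μ A B y - quant ν A B y| ^ r) ^ (1 / r)

/-- The Benford measure `β_b` on `[1,b]`: the law of `b^U` with `U` uniform on `[0,1)`. -/
def benford (b : ℝ) : Measure ℝ := (volume.restrict (Ico (0 : ℝ) 1)).map (fun t : ℝ => b ^ t)

/-- The map `T_{f,a}(x) = f₊(f⁻¹(x+a) + 2a) + a`. -/
def Tmap (f : ℝ → EReal) (a : ℝ) : EReal → EReal :=
  fun x => fplus f (upperInvE f (x + (a : EReal)) + ((2 * a : ℝ) : EReal)) + (a : EReal)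

/-- The map `S_{f,a}(x) = f₊(f⁻¹(x+a)) + a`. -/
def Smap (f : ℝ → EReal) (a : ℝ) : EReal → EReal :=
  fun x => fplus f (upperInvE f (x + (a : EReal))) + (a : EReal)

/-- `L_•^{•,n} = min {a ≥ 0 : T_{F_μ,a}^{[n]}(0) ≥ 1}`. -/
def LBB (μ : Measure ℝ) (A B : ℝ) (n : ℕ) : ℝ :=
  sInf {a : ℝ | 0 ≤ a ∧ (1 : EReal) ≤ (Tmap (cdfEReal μ A B) a)^[n] ((0 : ℝ) : EReal)}

/-- `K_•^{•,n} = min {a ≥ 0 : S_{F_μ,a}^{[n]}(0) ≥ 1}`. -/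
def KBB (μ : Measure ℝ) (A B : ℝ) (n : ℕ) : ℝ :=
  sInf {a : ℝ | 0 ≤ a ∧ (1 : EReal) ≤ (Smap (cdfEReal μ A B) a)^[n] ((0 : ℝ) : EReal)}


section Limits

variable {g : ℝ → ℝ}

lemma fminus_sub_le_iff (c : EReal) (x y : ℝ) :
    fminus (fun t => (g t : EReal)) c - (y : EReal) ≤ (x : EReal) ↔
      ∀ s : ℝ, (s : EReal) < c → g s - y ≤ x := by
  rw [EReal.sub_le_iff_le_add (by simp) (by simp), fminus, sSup_le_iff, forall_mem_image]
  refine forall_congr' fun s => imp_congr Iff.rfl ?_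
  rw [← EReal.coe_add, EReal.coe_le_coe_iff, sub_le_iff_le_add]

lemma le_fplus_add_iff (c : EReal) (x y : ℝ) :
    (x : EReal) ≤ fplus (fun t => (g t : EReal)) c + (y : EReal) ↔
      ∀ s : ℝ, c < (s : EReal) → x ≤ g s + y := by
  rw [← EReal.sub_le_iff_le_add (by simp) (by simp), fplus, le_sInf_iff, forall_mem_image]
  refine forall_congr' fun s => imp_congr Iff.rfl ?_
  rw [← EReal.coe_sub, EReal.coe_le_coe_iff, sub_le_iff_le_add]

lemma coe_lt_sub_coe_iff (c : EReal) (s y : ℝ) :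
    (s : EReal) < c - (y : EReal) ↔ ((s + y : ℝ) : EReal) < c := by
  rw [EReal.lt_sub_iff_add_lt (by simp) (by simp), EReal.coe_add]

lemma add_coe_lt_coe_iff (c : EReal) (s y : ℝ) :
    c + (y : EReal) < (s : EReal) ↔ c < ((s - y : ℝ) : EReal) := by
  rw [EReal.coe_sub, EReal.lt_sub_iff_add_lt (by simp) (by simp)]

/-- Admissibility of `y` in the definition of `ell`, in terms of real numbers only. -/
def EllAdm (g : ℝ → ℝ) (lo hi : EReal) (x y : ℝ) : Prop :=
  (∀ s : ℝ, ((s + y : ℝ) : EReal) < hi → g s - y ≤ x) ∧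
    ∀ s : ℝ, lo < ((s - y : ℝ) : EReal) → x ≤ g s + y

lemma ell_le_iff {lo hi : EReal} {x L : ℝ} (hL : 0 ≤ L)
    (hne : ∃ y, 0 ≤ y ∧ EllAdm g lo hi x y) :
    ell (fun t => (g t : EReal)) lo hi x ≤ L ↔ EllAdm g lo hi x L := by
  have hset : ell (fun t => (g t : EReal)) lo hi x = sInf {y | 0 ≤ y ∧ EllAdm g lo hi x y} := by
    simp only [ell, fminus_sub_le_iff, le_fplus_add_iff, coe_lt_sub_coe_iff, add_coe_lt_coe_iff,
      EllAdm]
  rw [hset]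
  refine ⟨fun h => ?_, fun h => csInf_le ⟨0, fun y hy => hy.1⟩ ⟨hL, h⟩⟩
  have key : ∀ y, L < y → ∃ y' < y, EllAdm g lo hi x y' := fun y hy => by
    obtain ⟨y', hy', hlt⟩ := exists_lt_of_csInf_lt hne (h.trans_lt hy)
    exact ⟨y', hlt, hy'.2⟩
  constructor
  · intro s hs
    obtain ⟨r, hr, hrhi⟩ := EReal.lt_iff_exists_real_btwn.1 hs
    rw [EReal.coe_lt_coe_iff] at hr
    by_contra! hlt
    obtain ⟨y, hy, hadm⟩ := key (min (r - s) (g s - x)) (lt_min (by linarith) (by linarith))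
    rw [lt_min_iff] at hy
    have := hadm.1 s (lt_trans (EReal.coe_lt_coe_iff.2 (by linarith)) hrhi)
    linarith
  · intro s hs
    obtain ⟨r, hlor, hr⟩ := EReal.lt_iff_exists_real_btwn.1 hs
    rw [EReal.coe_lt_coe_iff] at hr
    by_contra! hlt
    obtain ⟨y, hy, hadm⟩ := key (min (s - r) (x - g s)) (lt_min (by linarith) (by linarith))
    rw [lt_min_iff] at hy
    have := hadm.2 s (lt_trans hlor (EReal.coe_lt_coe_iff.2 (by linarith)))
    linarith

end Limits

section LevyClose

variable {F G : ℝ → ℝ} {a : ℝ}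

/-- The admissible set in the definition of the Lévy distance between `F` and `G`. -/
def levySet (F G : ℝ → ℝ) : Set ℝ :=
  {y : ℝ | 0 ≤ y ∧ ∀ t : ℝ, F (t - y) - y ≤ G t ∧ G t ≤ F (t + y) + y}

/-- `F` and `G` are within Lévy distance `a`, stated with strict shifts of the argument. -/
def LevyClose (F G : ℝ → ℝ) (a : ℝ) : Prop :=
  ∀ s t : ℝ, s + a < t → F s - a ≤ G t ∧ G s ≤ F t + a

lemma levyClose_of_mem_levySet (hF : Monotone F) (h : a ∈ levySet F G) : LevyClose F G a := by
  intro s t hst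
  have h1 := (h.2 t).1
  have h2 := (h.2 s).2
  have h3 := hF (show s ≤ t - a by linarith)
  have h4 := hF (show s + a ≤ t by linarith)
  exact ⟨by linarith, by linarith⟩

lemma sInf_levySet_le_iff (hF : Monotone F) (ha : 0 ≤ a) (hne : (levySet F G).Nonempty) :
    sInf (levySet F G) ≤ a ↔ LevyClose F G a := by
  constructor
  · intro h s t hst
    have key : ∀ y, a < y → ∃ y' < y, LevyClose F G y' := fun y hy => by
      obtain ⟨y', hy', hlt⟩ := exists_lt_of_csInf_lt hne (h.trans_lt hy)
      exact ⟨y', hlt, levyClose_of_mem_levySet hF hy'⟩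
    constructor
    · by_contra! hlt
      obtain ⟨y, hy, hc⟩ := key (min (t - s) (F s - G t)) (lt_min (by linarith) (by linarith))
      rw [lt_min_iff] at hy
      linarith [(hc s t (by linarith)).1]
    · by_contra! hlt
      obtain ⟨y, hy, hc⟩ := key (min (t - s) (G s - F t)) (lt_min (by linarith) (by linarith))
      rw [lt_min_iff] at hy
      linarith [(hc s t (by linarith)).2]
  · intro h
    refine le_of_forall_gt_imp_ge_of_dense fun y hy => csInf_le ⟨0, fun z hz => hz.1⟩
      ⟨by linarith, fun t => ?_⟩
    have h1 := (h (t - y) t (by linarith)).1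
    have h2 := (h t (t + y) (by linarith)).2
    exact ⟨by linarith, by linarith⟩

lemma one_mem_levySet (hF0 : ∀ t, 0 ≤ F t) (hF1 : ∀ t, F t ≤ 1) (hG0 : ∀ t, 0 ≤ G t)
    (hG1 : ∀ t, G t ≤ 1) : (1 : ℝ) ∈ levySet F G :=
  ⟨zero_le_one, fun t => ⟨by linarith [hF1 (t - 1), hG0 t], by linarith [hF0 (t + 1), hG1 t]⟩⟩

end LevyClose

section Discrete

variable {n : ℕ} {x p : Fin n → ℝ} {A B : ℝ}

lemma cdf_discr (hx : ∀ j, x j ∈ Icc A B) (hp : ∀ j, 0 ≤ p j) (t : ℝ) :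
    cdf (discr n x p) A B t = ∑ j, if x j ≤ t then p j else 0 := by
  have hm : MeasurableSet (Icc A B ∩ Iic t) := measurableSet_Icc.inter measurableSet_Iic
  rw [cdf, discr, Measure.finsetSum_apply, ENNReal.toReal_sum]
  · refine Finset.sum_congr rfl fun j _ => ?_
    rw [Measure.smul_apply, Measure.dirac_apply' _ hm]
    by_cases h : x j ≤ t
    · simp [h, hx j, indicator, hp j]
    · simp [h, indicator]
  · intro j _
    rw [Measure.smul_apply, Measure.dirac_apply' _ hm]
    by_cases h : x j ∈ Icc A B ∩ Iic t <;> simp [h, indicator]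

lemma psum_zero : psum n p 0 = 0 := by simp [psum]

lemma psum_top : psum n p n = ∑ j, p j := by simp [psum]

lemma psum_succ (j : Fin n) : psum n p (j + 1) = psum n p j + p j := by
  have : p j = ∑ k : Fin n, if k = j then p k else 0 := by simp
  rw [this, psum, psum, ← Finset.sum_add_distrib]
  refine Finset.sum_congr rfl fun k _ => ?_
  rcases lt_trichotomy (k : ℕ) j with h | h | h
  · have : k ≠ j := fun e => by simp [e] at h
    simp [h, this, Nat.lt_succ_of_lt h]
  · have : k = j := Fin.ext h
    simp [this]
  · have : k ≠ j := fun e => by simp [e] at h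
    simp [this, h.not_gt, show ¬ (k : ℕ) < j + 1 by omega]

lemma psum_le_one (hp : IsPi n p) (i : ℕ) : psum n p i ≤ 1 := by
  rw [← hp.2]
  refine Finset.sum_le_sum fun j _ => ?_
  split_ifs
  · exact le_rfl
  · exact hp.1 j

lemma psum_nonneg (hp : ∀ j, 0 ≤ p j) (i : ℕ) : 0 ≤ psum n p i :=
  Finset.sum_nonneg fun j _ => by split_ifs <;> simp [hp j]

lemma psum_le_cdf_discr (hx : ∀ j, x j ∈ Icc A B) (hp : ∀ j, 0 ≤ p j) {t : ℝ} {i : ℕ}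
    (h : ∀ j : Fin n, 0 < p j → (j : ℕ) < i → x j ≤ t) :
    psum n p i ≤ cdf (discr n x p) A B t := by
  rw [cdf_discr hx hp]
  refine Finset.sum_le_sum fun j _ => ?_
  rcases (hp j).eq_or_lt with h0 | h0
  · simp [← h0]
  · split_ifs with h1 h2
    · exact le_rfl
    · exact absurd (h j h0 h1) h2
    · exact h0.le
    · exact le_rfl

lemma cdf_discr_le_psum (hx : ∀ j, x j ∈ Icc A B) (hp : ∀ j, 0 ≤ p j) {t : ℝ} {i : ℕ}
    (h : ∀ j : Fin n, 0 < p j → x j ≤ t → (j : ℕ) < i) :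
    cdf (discr n x p) A B t ≤ psum n p i := by
  rw [cdf_discr hx hp]
  refine Finset.sum_le_sum fun j _ => ?_
  rcases (hp j).eq_or_lt with h0 | h0
  · simp [← h0]
  · split_ifs with h1 h2
    · exact le_rfl
    · exact absurd (h j h0 h1) h2
    · exact h0.le
    · exact le_rfl

lemma cdf_discr_nonneg (t : ℝ) : 0 ≤ cdf (discr n x p) A B t := ENNReal.toReal_nonneg

lemma cdf_discr_le_one (hx : ∀ j, x j ∈ Icc A B) (hp : IsPi n p) (t : ℝ) :
    cdf (discr n x p) A B t ≤ 1 :=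
  (cdf_discr_le_psum hx hp.1 (i := n) fun j _ _ => j.2).trans (psum_le_one hp n)

lemma extPts_zero : extPts n x 0 = ⊥ := by simp [extPts]

lemma extPts_succ (j : Fin n) : extPts n x (j + 1) = x j := by
  have : (j : ℕ) + 1 ≤ n := j.2
  simp [extPts, this]

lemma extPts_top : extPts n x (n + 1) = ⊤ := by simp [extPts]

/-- Locations and weights are compatible with the distribution function `F` up to an error `a`
at every atom, degenerate or not. -/
def AtomAdm (F : ℝ → ℝ) (x p : Fin n → ℝ) (a : ℝ) : Prop :=
  ∀ j : Fin n, (∀ s, s + a < x j → F s - a ≤ psum n p j) ∧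
    ∀ s, x j + a < s → psum n p (j + 1) ≤ F s + a

variable {F : ℝ → ℝ} {a : ℝ}

lemma atomAdm_of_levyClose (hx : IsXi A B n x) (hp : IsPi n p)
    (h : LevyClose F (cdf (discr n x p) A B) a) : AtomAdm F x p a := by
  refine fun j => ⟨fun s hs => ?_, fun s hs => ?_⟩
  · obtain ⟨t, hst, htx⟩ := exists_between hs
    refine (h s t hst).1.trans (cdf_discr_le_psum hx.1 hp.1 fun k _ hk => ?_)
    by_contra! hjk
    exact absurd (hx.2 (show j ≤ k from hjk)) (by linarith)
  · refine le_trans (psum_le_cdf_discr hx.1 hp.1 fun k _ hk => ?_) (h (x j) s hs).2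
    exact hx.2 (Fin.le_def.2 (Nat.lt_succ_iff.1 hk))

lemma ellAdm_of_atomAdm (hF0 : ∀ t, 0 ≤ F t) (hF1 : ∀ t, F t ≤ 1) (hp : IsPi n p) (ha : 0 ≤ a)
    (h : AtomAdm F x p a) (j : ℕ) (hj : j ≤ n) :
    EllAdm F (extPts n x j) (extPts n x (j + 1)) (psum n p j) a := by
  constructor
  · intro s hs
    rcases hj.lt_or_eq with hlt | rfl
    · have e := extPts_succ (x := x) ⟨j, hlt⟩
      simp only at e
      rw [e, EReal.coe_lt_coe_iff] at hs
      exact (h ⟨j, hlt⟩).1 s hs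
    · rw [psum_top, hp.2]
      linarith [hF1 s]
  · intro s hs
    rcases Nat.eq_zero_or_pos j with rfl | hpos
    · rw [psum_zero]
      linarith [hF0 s]
    · obtain ⟨k, rfl⟩ : ∃ k, j = k + 1 := ⟨j - 1, by omega⟩
      have e := extPts_succ (x := x) ⟨k, by omega⟩
      simp only at e
      rw [e, EReal.coe_lt_coe_iff] at hs
      exact (h ⟨k, by omega⟩).2 s (by linarith)

lemma levyClose_of_ellAdm (hx : IsXi A B n x) (hp : IsPi n p)
    (h : ∀ j : ℕ, j ≤ n → extPts n x j < extPts n x (j + 1) →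
      EllAdm F (extPts n x j) (extPts n x (j + 1)) (psum n p j) a) :
    LevyClose F (cdf (discr n x p) A B) a := by
  have key : ∀ t : ℝ, ∃ j ≤ n, extPts n x j ≤ t ∧ (t : EReal) < extPts n x (j + 1) ∧
      cdf (discr n x p) A B t = psum n p j := by
    intro t
    classical
    have hex : ∃ j, (t : EReal) < extPts n x (j + 1) := ⟨n, by simp [extPts_top]⟩
    have hle : Nat.find hex ≤ n := Nat.find_min' hex (by simp [extPts_top])
    have hlt : ∀ k : Fin n, (k : ℕ) < Nat.find hex → x k ≤ t := fun k hk => by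
      have := Nat.find_min hex hk
      rw [extPts_succ, EReal.coe_lt_coe_iff] at this
      exact not_lt.1 this
    refine ⟨Nat.find hex, hle, ?_, Nat.find_spec hex, le_antisymm ?_ ?_⟩
    · rcases Nat.eq_zero_or_pos (Nat.find hex) with h0 | hpos
      · rw [h0, extPts_zero]
        exact bot_le
      · have := Nat.find_min hex (Nat.sub_lt hpos one_pos)
        rw [show Nat.find hex - 1 + 1 = Nat.find hex by omega] at this
        exact not_lt.1 this
    · refine cdf_discr_le_psum hx.1 hp.1 fun k _ hk => ?_
      by_contra! hjk
      have e := extPts_succ (x := x) ⟨Nat.find hex, hjk.trans_lt k.2⟩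
      have hs := Nat.find_spec hex
      simp only at e
      rw [e, EReal.coe_lt_coe_iff] at hs
      exact absurd (hx.2 (show (⟨Nat.find hex, hjk.trans_lt k.2⟩ : Fin n) ≤ k from hjk))
        (by linarith)
    · exact psum_le_cdf_discr hx.1 hp.1 fun k _ hk => hlt k hk
  intro s t hst
  constructor
  · obtain ⟨j, hj, h1, h2, he⟩ := key t
    rw [he]
    exact (h j hj (h1.trans_lt h2)).1 s (lt_trans (EReal.coe_lt_coe_iff.2 hst) h2)
  · obtain ⟨j, hj, h1, h2, he⟩ := key s
    rw [he]
    exact (h j hj (h1.trans_lt h2)).2 t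
      (h1.trans_lt (EReal.coe_lt_coe_iff.2 (by linarith)))

end Discrete

section Cdf

variable {μ : Measure ℝ} {A B : ℝ}

lemma cdf_nonneg (t : ℝ) : 0 ≤ cdf μ A B t := ENNReal.toReal_nonneg

lemma cdf_eq_zero {t : ℝ} (h : t < A) : cdf μ A B t = 0 := by
  have : Icc A B ∩ Iic t = ∅ := by
    ext y
    simp only [mem_inter_iff, mem_Icc, mem_Iic, mem_empty_iff_false, iff_false]
    rintro ⟨⟨h1, -⟩, h2⟩
    linarith
  simp [cdf, this]

lemma cdf_eq_one (hμ : μ (Icc A B) = 1) {t : ℝ} (h : B ≤ t) : cdf μ A B t = 1 := by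
  have : Icc A B ∩ Iic t = Icc A B := inter_eq_left.2 fun y hy => hy.2.trans h
  simp [cdf, this, hμ]

lemma cdf_left (hAB : A ≤ B) : cdf μ A B A = (μ {A}).toReal := by
  have : Icc A B ∩ Iic A = {A} := by
    ext y
    simp only [mem_inter_iff, mem_Icc, mem_Iic, mem_singleton_iff]
    refine ⟨fun h => le_antisymm h.2 h.1.1, ?_⟩
    rintro rfl
    exact ⟨⟨le_rfl, hAB⟩, le_rfl⟩
  rw [cdf, this]

lemma quant_mem_Icc (hAB : A ≤ B) (v : ℝ) : quant μ A B v ∈ Icc A B := by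
  rw [quant]
  split_ifs with h
  · exact ⟨le_rfl, hAB⟩
  · push Not at h
    have hA : A ∈ {y ∈ Icc A B | cdf μ A B y ≤ v} :=
      ⟨⟨le_rfl, hAB⟩, (cdf_left hAB).trans_le h.1⟩
    exact ⟨le_csSup ⟨B, fun y hy => hy.1.2⟩ hA, csSup_le ⟨A, hA⟩ fun y hy => hy.1.2⟩

variable [IsProbabilityMeasure μ]

lemma cdf_mono : Monotone (cdf μ A B) := fun _ _ h =>
  ENNReal.toReal_mono (measure_ne_top _ _)
    (measure_mono (inter_subset_inter_right _ (Iic_subset_Iic.2 h)))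

lemma cdf_le_one (t : ℝ) : cdf μ A B t ≤ 1 :=
  ENNReal.toReal_le_of_le_ofReal zero_le_one (by simpa using prob_le_one)

lemma le_quant (hAB : A ≤ B) {r v : ℝ} (hr : r ≤ B) (h : cdf μ A B r ≤ v) :
    r ≤ quant μ A B v := by
  rcases le_or_gt r A with hA | hA
  · exact hA.trans (quant_mem_Icc hAB v).1
  · have h1 : (μ {A}).toReal ≤ v := by
      rw [← cdf_left hAB]
      exact (cdf_mono hA.le).trans h
    have h2 : 0 ≤ v := (cdf_nonneg r).trans h
    rw [quant, if_neg (by push Not; exact ⟨h1, h2⟩)]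
    exact le_csSup ⟨B, fun y hy => hy.1.2⟩ ⟨⟨hA.le, hr⟩, h⟩

lemma cdf_le_of_lt_quant {r v : ℝ} (hAB : A ≤ B) (hv : 0 ≤ v) (h : r < quant μ A B v) :
    cdf μ A B r ≤ v := by
  rw [quant] at h
  split_ifs at h with hc
  · rw [cdf_eq_zero h]
    exact hv
  · push Not at hc
    have hA : A ∈ {y ∈ Icc A B | cdf μ A B y ≤ v} :=
      ⟨⟨le_rfl, hAB⟩, (cdf_left hAB).trans_le hc.1⟩
    obtain ⟨z, hz, hrz⟩ := exists_lt_of_lt_csSup ⟨A, hA⟩ h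
    exact (cdf_mono hrz.le).trans hz.2

lemma quant_le (hAB : A ≤ B) {r v : ℝ} (hr : A ≤ r) (h : v < cdf μ A B r) :
    quant μ A B v ≤ r := by
  rcases lt_or_ge v 0 with hv | hv
  · rw [quant, if_pos (Or.inr hv)]
    exact hr
  · by_contra! hlt
    exact absurd (cdf_le_of_lt_quant hAB hv hlt) (not_le.2 h)

variable {n : ℕ} {x p : Fin n → ℝ} {a : ℝ}

lemma ellAdm_quant_of_atomAdm (hAB : A ≤ B) (hx : IsXi A B n x) (ha : 0 ≤ a)
    (h : AtomAdm (cdf μ A B) x p a) (j : Fin n) :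
    EllAdm (quant μ A B) (psum n p j : ℝ) (psum n p (j + 1) : ℝ) (x j) a := by
  constructor
  · intro v hv
    rw [EReal.coe_lt_coe_iff] at hv
    rw [sub_le_iff_le_add]
    refine le_of_forall_gt_imp_ge_of_dense fun r hr => ?_
    refine quant_le hAB (by linarith [(hx.1 j).1]) ?_
    linarith [(h j).2 r hr]
  · intro v hv
    rw [EReal.coe_lt_coe_iff] at hv
    rw [← sub_le_iff_le_add]
    refine le_of_forall_lt_imp_le_of_dense fun r hr => ?_
    refine le_quant hAB (by linarith [(hx.1 j).2]) ?_
    linarith [(h j).1 r (by linarith)]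

lemma levyClose_of_ellAdm_quant (hAB : A ≤ B) (hμ : μ (Icc A B) = 1) (hx : IsXi A B n x)
    (hp : IsPi n p) (ha : 0 ≤ a)
    (h : ∀ j : Fin n, psum n p j < psum n p (j + 1) →
      EllAdm (quant μ A B) (psum n p j : ℝ) (psum n p (j + 1) : ℝ) (x j) a) :
    LevyClose (cdf μ A B) (cdf (discr n x p) A B) a := by
  classical
  have hact : ∀ j : Fin n, 0 < p j →
      EllAdm (quant μ A B) (psum n p j : ℝ) (psum n p (j + 1) : ℝ) (x j) a := fun j hj =>
    h j (by rw [psum_succ]; linarith)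
  intro s t hst
  constructor
  · rcases (Finset.univ.filter fun j : Fin n => 0 < p j ∧ t < x j).eq_empty_or_nonempty with
      he | hne
    · have h1 : psum n p n ≤ cdf (discr n x p) A B t :=
        psum_le_cdf_discr hx.1 hp.1 fun j hj _ => by
          by_contra! hlt
          exact (Finset.eq_empty_iff_forall_notMem.1 he j) (by simp [hj, hlt])
      rw [psum_top, hp.2] at h1
      linarith [cdf_le_one (μ := μ) (A := A) (B := B) s]
    · obtain ⟨j, hj, hmin⟩ := Finset.exists_min_image _ (fun j : Fin n => j) hne
      simp only [Finset.mem_filter, Finset.mem_univ, true_and] at hj hmin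
      have h1 : psum n p j ≤ cdf (discr n x p) A B t :=
        psum_le_cdf_discr hx.1 hp.1 fun k hk hkj => by
          by_contra! hlt
          exact absurd (hmin k ⟨hk, hlt⟩) (not_le.2 hkj)
      have h2 : cdf μ A B s ≤ psum n p j + a := by
        refine le_of_forall_gt_imp_ge_of_dense fun v hv => ?_
        have h3 := (hact j hj.1).2 v (EReal.coe_lt_coe_iff.2 (by linarith))
        exact cdf_le_of_lt_quant hAB (by linarith [psum_nonneg hp.1 j]) (by linarith)
      linarith
  · rcases (Finset.univ.filter fun j : Fin n => 0 < p j ∧ x j ≤ s).eq_empty_or_nonempty with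
      he | hne
    · have h1 : cdf (discr n x p) A B s ≤ psum n p 0 :=
        cdf_discr_le_psum hx.1 hp.1 fun j hj hjs =>
          absurd (Finset.eq_empty_iff_forall_notMem.1 he j) (by simp [hj, hjs])
      rw [psum_zero] at h1
      linarith [cdf_nonneg (μ := μ) (A := A) (B := B) t]
    · obtain ⟨j, hj, hmax⟩ := Finset.exists_max_image _ (fun j : Fin n => j) hne
      simp only [Finset.mem_filter, Finset.mem_univ, true_and] at hj hmax
      have h1 : cdf (discr n x p) A B s ≤ psum n p (j + 1) :=
        cdf_discr_le_psum hx.1 hp.1 fun k hk hks =>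
          Nat.lt_succ_of_le (Fin.le_def.1 (hmax k ⟨hk, hks⟩))
      refine h1.trans ?_
      by_contra! hlt
      obtain ⟨v, hv1, hv2⟩ := exists_between (lt_sub_iff_add_lt.2 hlt)
      have h3 := (hact j hj.1).1 v (EReal.coe_lt_coe_iff.2 (by linarith))
      have h4 : t ≤ B := by
        by_contra! hB
        rw [cdf_eq_one hμ hB.le] at hlt
        linarith [psum_le_one hp (j + 1)]
      have h5 := le_quant hAB h4 hv1.le
      linarith [hj.2]

end Cdf

section Iterates

variable {F : ℝ → ℝ} {a : ℝ}

lemma Tmap_lt_iff (hF : Monotone F) (u v : EReal) :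
    Tmap (fun t => (F t : EReal)) a u < v ↔
      ∃ r s : ℝ, r + 2 * a < s ∧ u < ((F r - a : ℝ) : EReal) ∧ ((F s + a : ℝ) : EReal) < v := by
  have hv (z : EReal) : z + (a : EReal) < v ↔ z < v - (a : EReal) :=
    (EReal.lt_sub_iff_add_lt (by simp) (by simp)).symm
  have hu (r : ℝ) : u < ((F r - a : ℝ) : EReal) ↔ u + a < F r := by
    rw [EReal.coe_sub, EReal.lt_sub_iff_add_lt (by simp) (by simp)]
  simp only [hu]
  rw [Tmap, hv, fplus, sInf_lt_iff]
  constructor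
  · rintro ⟨_, ⟨s, hs, rfl⟩, hsv⟩
    obtain ⟨r, hr, hrs⟩ := EReal.lt_iff_exists_real_btwn.1 (show _ < (s : EReal) from hs)
    rw [EReal.coe_lt_coe_iff] at hrs
    rw [add_coe_lt_coe_iff] at hr
    refine ⟨r - 2 * a, s, by linarith, ?_, by rw [EReal.coe_add, hv]; exact hsv⟩
    by_contra! hle
    exact absurd hr (not_lt.2 (le_sSup ⟨_, hle, rfl⟩))
  · rintro ⟨r, s, hrs, hur, hsv⟩
    refine ⟨_, ⟨s, ?_, rfl⟩, by rwa [← hv, ← EReal.coe_add]⟩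
    rw [mem_ofPred_eq, add_coe_lt_coe_iff]
    refine lt_of_le_of_lt (b := (r : EReal)) (sSup_le ?_) (EReal.coe_lt_coe_iff.2 (by linarith))
    rintro _ ⟨z, hz, rfl⟩
    refine EReal.coe_le_coe_iff.2 (le_of_not_gt fun hlt => ?_)
    exact absurd (hur.trans_le (EReal.coe_le_coe_iff.2 (hF hlt.le))) (not_lt.2 hz)

lemma Tmap_mono (hF : Monotone F) : Monotone (Tmap (fun t => (F t : EReal)) a) := by
  intro u w huw
  refine le_of_forall_gt_imp_ge_of_dense fun v hv => ?_
  obtain ⟨r, s, h1, h2, h3⟩ := (Tmap_lt_iff hF w v).1 hv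
  exact ((Tmap_lt_iff hF u v).2 ⟨r, s, h1, huw.trans_lt h2, h3⟩).le

lemma Tmap_nonneg (hF : Monotone F) (hF0 : ∀ t, 0 ≤ F t) (ha : 0 ≤ a) (u : EReal) :
    0 ≤ Tmap (fun t => (F t : EReal)) a u := by
  by_contra! h
  obtain ⟨r, s, -, -, h3⟩ := (Tmap_lt_iff hF u 0).1 h
  rw [← EReal.coe_zero, EReal.coe_lt_coe_iff] at h3
  linarith [hF0 s]

lemma iterate_Tmap_mono (hF : Monotone F) (hF0 : ∀ t, 0 ≤ F t) (ha : 0 ≤ a) :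
    Monotone fun i : ℕ => (Tmap (fun t => (F t : EReal)) a)^[i] ((0 : ℝ) : EReal) :=
  (Tmap_mono hF).monotone_iterate_of_le_map (by simpa using Tmap_nonneg hF hF0 ha 0)

lemma psum_le_iterate_Tmap (hF : Monotone F) {n : ℕ} {x p : Fin n → ℝ}
    (h : AtomAdm F x p a) (i : ℕ) (hi : i ≤ n) :
    ((psum n p i : ℝ) : EReal) ≤ (Tmap (fun t => (F t : EReal)) a)^[i] ((0 : ℝ) : EReal) := by
  induction i with
  | zero => simp [psum_zero]
  | succ i ih =>
    specialize ih (by omega)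
    rw [Function.iterate_succ_apply']
    by_contra! hlt
    obtain ⟨r, s, h1, h2, h3⟩ := (Tmap_lt_iff hF _ _).1 hlt
    have h4 := EReal.coe_lt_coe_iff.1 (ih.trans_lt h2)
    rw [EReal.coe_lt_coe_iff] at h3
    have h5 := (h ⟨i, hi⟩).1 r
    have h6 := (h ⟨i, hi⟩).2 s
    simp only at h5 h6
    rcases lt_or_ge (r + a) (x ⟨i, hi⟩) with hc | hc
    · linarith [h5 hc]
    · linarith [h6 (by linarith)]

open Topology in
/-- Iterates of `Tmap` are upper semicontinuous from the right in the parameter. -/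
lemma eventually_iterate_Tmap_lt (hF : Monotone F) (a₀ : ℝ) (i : ℕ) (v : EReal)
    (hv : (Tmap (fun t => (F t : EReal)) a₀)^[i] ((0 : ℝ) : EReal) < v) :
    ∀ᶠ a in 𝓝 a₀, (Tmap (fun t => (F t : EReal)) a)^[i] ((0 : ℝ) : EReal) < v := by
  induction i generalizing v with
  | zero => exact Eventually.of_forall fun a => hv
  | succ i ih =>
    simp only [Function.iterate_succ_apply'] at hv ⊢
    obtain ⟨r, s, h1, h2, h3⟩ := (Tmap_lt_iff hF _ _).1 hv
    obtain ⟨w, hw1, hw2⟩ := EReal.lt_iff_exists_real_btwn.1 h2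
    obtain ⟨z, hz1, hz2⟩ := EReal.lt_iff_exists_real_btwn.1 h3
    rw [EReal.coe_lt_coe_iff] at hw2 hz1
    have e1 : ∀ᶠ a in 𝓝 a₀, r + 2 * a < s :=
      (show Continuous fun a : ℝ => r + 2 * a by fun_prop).continuousAt.eventually_lt_const h1
    have e2 : ∀ᶠ a in 𝓝 a₀, w < F r - a :=
      (show Continuous fun a : ℝ => F r - a by fun_prop).continuousAt.eventually_const_lt hw2
    have e3 : ∀ᶠ a in 𝓝 a₀, F s + a < z :=
      (show Continuous fun a : ℝ => F s + a by fun_prop).continuousAt.eventually_lt_const hz1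
    filter_upwards [e1, e2, e3, ih w hw1] with a h1 h2 h3 h4
    exact (Tmap_lt_iff hF _ _).2 ⟨r, s, h1, h4.trans (EReal.coe_lt_coe_iff.2 h2),
      (EReal.coe_lt_coe_iff.2 h3).trans hz2⟩

/-- The best location of an atom, given that the mass to its left is `u`: the clamped value of
`F⁻¹(u + a) + a`. -/
def atomLoc (F : ℝ → ℝ) (A B a : ℝ) (u : EReal) : ℝ :=
  sSup {z ∈ Icc A B | z = A ∨ ((F (z - a) - a : ℝ) : EReal) ≤ u}

variable {A B : ℝ}

lemma bddAbove_atomLoc (u : EReal) :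
    BddAbove {z ∈ Icc A B | z = A ∨ ((F (z - a) - a : ℝ) : EReal) ≤ u} :=
  ⟨B, fun _ hz => hz.1.2⟩

lemma left_mem_atomLoc (hAB : A ≤ B) (u : EReal) :
    A ∈ {z ∈ Icc A B | z = A ∨ ((F (z - a) - a : ℝ) : EReal) ≤ u} :=
  ⟨⟨le_rfl, hAB⟩, Or.inl rfl⟩

lemma atomLoc_mem_Icc (hAB : A ≤ B) (u : EReal) : atomLoc F A B a u ∈ Icc A B :=
  ⟨le_csSup (bddAbove_atomLoc u) (left_mem_atomLoc hAB u),
    csSup_le ⟨A, left_mem_atomLoc hAB u⟩ fun _ hz => hz.1.2⟩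

lemma atomLoc_mono (hAB : A ≤ B) : Monotone (atomLoc F A B a) := fun u w huw =>
  csSup_le_csSup (bddAbove_atomLoc w) ⟨A, left_mem_atomLoc hAB u⟩
    fun _ hz => ⟨hz.1, hz.2.imp_right fun h => h.trans huw⟩

lemma sub_le_of_lt_atomLoc (hF : Monotone F) (hFA : ∀ t < A, F t = 0) (hAB : A ≤ B)
    (ha : 0 ≤ a) {u : EReal} (hu : 0 ≤ u) {s : ℝ} (hs : s + a < atomLoc F A B a u) :
    ((F s - a : ℝ) : EReal) ≤ u := by
  obtain ⟨z, ⟨-, hz⟩, hsz⟩ := exists_lt_of_lt_csSup ⟨A, left_mem_atomLoc hAB u⟩ hs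
  rcases hz with rfl | hz
  · refine le_trans ?_ hu
    rw [hFA s (by linarith), ← EReal.coe_zero, EReal.coe_le_coe_iff]
    linarith
  · exact le_trans (EReal.coe_le_coe_iff.2 (by linarith [hF (show s ≤ z - a by linarith)])) hz

lemma min_Tmap_le_of_atomLoc_lt (hF : Monotone F) (hFB : ∀ t, B ≤ t → F t = 1) (hAB : A ≤ B)
    (ha : 0 ≤ a) {u : EReal} {s : ℝ} (hs : atomLoc F A B a u + a < s) :
    min 1 (Tmap (fun t => (F t : EReal)) a u) ≤ ((F s + a : ℝ) : EReal) := by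
  by_contra! hlt
  rw [lt_min_iff, ← EReal.coe_one, EReal.coe_lt_coe_iff] at hlt
  have hsB : s < B := by
    by_contra! hB
    linarith [hFB s hB]
  obtain ⟨z, hz1, hz2⟩ := exists_between (lt_sub_iff_add_lt.2 hs)
  have hloc := (atomLoc_mem_Icc (F := F) (a := a) hAB u).1
  have hz : u < ((F (z - a) - a : ℝ) : EReal) := by
    by_contra! hle
    exact absurd (le_csSup (bddAbove_atomLoc u)
      ⟨⟨by linarith, by linarith⟩, Or.inr hle⟩ : z ≤ atomLoc F A B a u) (not_le.2 hz1)
  obtain ⟨v, hv1, hv2⟩ := exists_between hlt.2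
  exact absurd ((Tmap_lt_iff hF u v).2 ⟨z - a, s, by linarith, hz, hv1⟩) (not_lt.2 hv2.le)

lemma exists_atomAdm (hF : Monotone F) (hF0 : ∀ t, 0 ≤ F t) (hF1 : ∀ t, F t ≤ 1)
    (hFA : ∀ t < A, F t = 0) (hFB : ∀ t, B ≤ t → F t = 1) (hAB : A ≤ B) (ha : 0 ≤ a) (n : ℕ)
    (hn : (1 : EReal) ≤ (Tmap (fun t => (F t : EReal)) a)^[n] ((0 : ℝ) : EReal)) :
    ∃ x p : Fin n → ℝ, IsXi A B n x ∧ IsPi n p ∧ AtomAdm F x p a := by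
  set u : ℕ → EReal := fun i => (Tmap (fun t => (F t : EReal)) a)^[i] ((0 : ℝ) : EReal) with hu
  have umono : Monotone u := iterate_Tmap_mono hF hF0 ha
  have u0 : u 0 = 0 := by simp [hu]
  have unonneg : ∀ i, 0 ≤ u i := fun i => u0 ▸ umono (Nat.zero_le i)
  have hP : ∀ i, ∃ P : ℝ, (P : EReal) = min 1 (u i) := fun i =>
    ⟨(min 1 (u i)).toReal, EReal.coe_toReal
      (ne_top_of_le_ne_top (EReal.coe_ne_top 1) (min_le_left _ _))
      (ne_bot_of_le_ne_bot EReal.zero_ne_bot (le_min zero_le_one (unonneg i)))⟩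
  choose P hP using hP
  have Pmono : Monotone P := fun i k hik => by
    rw [← EReal.coe_le_coe_iff, hP, hP]
    exact min_le_min_left 1 (umono hik)
  have P0 : P 0 = 0 := by
    rw [← EReal.coe_eq_coe_iff, hP, u0]
    simp
  have Pn : P n = 1 := by
    rw [← EReal.coe_eq_coe_iff, hP]
    exact min_eq_left hn
  let p : Fin n → ℝ := fun j => P (j + 1) - P j
  have hps : ∀ i ≤ n, psum n p i = P i := by
    intro i
    induction i with
    | zero => simp [psum_zero, P0]
    | succ i ih =>
      intro hi
      have e := psum_succ (p := p) ⟨i, hi⟩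
      simp only at e
      rw [e, ih (by omega)]
      simp [p]
  refine ⟨fun j => atomLoc F A B a (u j), p, ⟨fun j => atomLoc_mem_Icc hAB _, fun i j hij =>
    atomLoc_mono hAB (umono hij)⟩, ⟨fun j => sub_nonneg.2 (Pmono (Nat.le_succ _)), ?_⟩, ?_⟩
  · rw [← psum_top, hps n le_rfl, Pn]
  · refine fun j => ⟨fun s hs => ?_, fun s hs => ?_⟩
    · rw [hps j j.2.le, ← EReal.coe_le_coe_iff, hP]
      refine le_min ?_ (sub_le_of_lt_atomLoc hF hFA hAB ha (unonneg _) hs)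
      rw [← EReal.coe_one, EReal.coe_le_coe_iff]
      linarith [hF1 s]
    · rw [hps _ j.2, ← EReal.coe_le_coe_iff, hP]
      have := min_Tmap_le_of_atomLoc_lt hF hFB hAB ha hs
      rwa [← Function.iterate_succ_apply' (Tmap _ a) j] at this

end Iterates

section Optimum

variable {μ : Measure ℝ} {A B : ℝ} {n : ℕ} {x p : Fin n → ℝ} {a : ℝ}

lemma LBB_nonneg : 0 ≤ LBB μ A B n := Real.sInf_nonneg fun _ h => h.1

variable [IsProbabilityMeasure μ]

lemma one_le_iterate_of_levyClose (hx : IsXi A B n x) (hp : IsPi n p)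
    (h : LevyClose (cdf μ A B) (cdf (discr n x p) A B) a) :
    (1 : EReal) ≤ (Tmap (cdfEReal μ A B) a)^[n] ((0 : ℝ) : EReal) := by
  have := psum_le_iterate_Tmap cdf_mono (atomAdm_of_levyClose hx hp h) n le_rfl
  rwa [psum_top, hp.2] at this

lemma levySet_nonempty (hx : IsXi A B n x) (hp : IsPi n p) :
    (levySet (cdf μ A B) (cdf (discr n x p) A B)).Nonempty :=
  ⟨1, one_mem_levySet cdf_nonneg cdf_le_one cdf_discr_nonneg (cdf_discr_le_one hx.1 hp)⟩

lemma LBB_le_sInf_levySet (hx : IsXi A B n x) (hp : IsPi n p) :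
    LBB μ A B n ≤ sInf (levySet (cdf μ A B) (cdf (discr n x p) A B)) :=
  le_csInf (levySet_nonempty hx hp) fun _ hy => csInf_le ⟨0, fun _ h => h.1⟩
    ⟨hy.1, one_le_iterate_of_levyClose hx hp (levyClose_of_mem_levySet cdf_mono hy)⟩

/-- The infimum defining `LBB` is attained. -/
lemma one_le_iterate_LBB (hAB : A ≤ B) (hn : 0 < n) :
    (1 : EReal) ≤ (Tmap (cdfEReal μ A B) (LBB μ A B n))^[n] ((0 : ℝ) : EReal) := by
  by_contra! hlt
  have hev := eventually_iterate_Tmap_lt cdf_mono _ n 1 hlt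
  obtain ⟨ε, hε, hball⟩ := Metric.eventually_nhds_iff.1 hev
  have hne : {a : ℝ | 0 ≤ a ∧
      (1 : EReal) ≤ (Tmap (cdfEReal μ A B) a)^[n] ((0 : ℝ) : EReal)}.Nonempty := by
    have hx : IsXi A B n fun _ => A := ⟨fun _ => ⟨le_rfl, hAB⟩, fun _ _ _ => le_rfl⟩
    have hp : IsPi n fun j => if j = ⟨0, hn⟩ then 1 else 0 :=
      ⟨fun j => by dsimp only; split_ifs <;> simp, by simp⟩
    obtain ⟨y, hy⟩ := levySet_nonempty (μ := μ) hx hp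
    exact ⟨y, hy.1, one_le_iterate_of_levyClose hx hp (levyClose_of_mem_levySet cdf_mono hy)⟩
  obtain ⟨y, hy, hylt⟩ := exists_lt_of_csInf_lt hne (lt_add_of_pos_right (LBB μ A B n) hε)
  have hle : LBB μ A B n ≤ y := csInf_le ⟨0, fun _ h => h.1⟩ hy
  refine absurd (hball (y := y) ?_) (not_lt.2 hy.2)
  rw [Real.dist_eq, abs_of_nonneg (sub_nonneg.2 hle)]
  linarith

end Optimum

/-- Thm. 3.9: existence and characterization of best (unconstrained)
Lévy-distance approximations of `μ` by measures with at most `n` atoms. -/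
theorem best_dLevy (A B : ℝ) (hAB : A < B) (μ : Measure ℝ) [IsProbabilityMeasure μ]
    (hμ : μ (Icc A B) = 1) (n : ℕ) (hn : 0 < n) :
    (∃ x p : Fin n → ℝ, IsXi A B n x ∧ IsPi n p ∧
      (∀ y q : Fin n → ℝ, IsXi A B n y → IsPi n q →
        dLevy A B μ (discr n x p) ≤ dLevy A B μ (discr n y q)) ∧
      dLevy A B μ (discr n x p) = omegaI A B * LBB μ A B n) ∧
    ∀ x p : Fin n → ℝ, IsXi A B n x → IsPi n p →
      (((∀ y q : Fin n → ℝ, IsXi A B n y → IsPi n q →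
          dLevy A B μ (discr n x p) ≤ dLevy A B μ (discr n y q)) ↔
        (∀ j : ℕ, j ≤ n → extPts n x j < extPts n x (j + 1) →
          ell (cdfEReal μ A B) (extPts n x j) (extPts n x (j + 1)) (psum n p j) ≤
            LBB μ A B n)) ∧
      ((∀ y q : Fin n → ℝ, IsXi A B n y → IsPi n q →
          dLevy A B μ (discr n x p) ≤ dLevy A B μ (discr n y q)) ↔
        (∀ j : Fin n, psum n p (j : ℕ) < psum n p ((j : ℕ) + 1) →
          ell (quantEReal μ A B)
              ((psum n p (j : ℕ) : ℝ) : EReal) ((psum n p ((j : ℕ) + 1) : ℝ) : EReal) (x j) ≤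
            LBB μ A B n))) := by
  have hω : 0 < omegaI A B := div_pos (lt_max_of_lt_left one_pos) (sub_pos.2 hAB)
  have hd : ∀ y q : Fin n → ℝ, dLevy A B μ (discr n y q) =
      omegaI A B * sInf (levySet (cdf μ A B) (cdf (discr n y q) A B)) := fun _ _ => rfl
  have hL : 0 ≤ LBB μ A B n := LBB_nonneg
  obtain ⟨x₀, p₀, hx₀, hp₀, h₀⟩ := exists_atomAdm cdf_mono cdf_nonneg cdf_le_one
    (fun _ => cdf_eq_zero) (fun _ => cdf_eq_one hμ) hAB.le hL n (one_le_iterate_LBB hAB.le hn)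
  have hclose : LevyClose (cdf μ A B) (cdf (discr n x₀ p₀) A B) (LBB μ A B n) :=
    levyClose_of_ellAdm hx₀ hp₀ fun j hj _ =>
      ellAdm_of_atomAdm cdf_nonneg cdf_le_one hp₀ hL h₀ j hj
  have hopt : sInf (levySet (cdf μ A B) (cdf (discr n x₀ p₀) A B)) = LBB μ A B n :=
    le_antisymm ((sInf_levySet_le_iff cdf_mono hL (levySet_nonempty hx₀ hp₀)).2 hclose)
      (LBB_le_sInf_levySet hx₀ hp₀)
  have hbest : ∀ x p : Fin n → ℝ, IsXi A B n x → IsPi n p →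
      ((∀ y q : Fin n → ℝ, IsXi A B n y → IsPi n q →
          dLevy A B μ (discr n x p) ≤ dLevy A B μ (discr n y q)) ↔
        LevyClose (cdf μ A B) (cdf (discr n x p) A B) (LBB μ A B n)) := by
    intro x p hx hp
    rw [← sInf_levySet_le_iff cdf_mono hL (levySet_nonempty hx hp)]
    simp only [hd, mul_le_mul_iff_of_pos_left hω]
    exact ⟨fun h => hopt ▸ h x₀ p₀ hx₀ hp₀,
      fun h y q hy hq => h.trans (LBB_le_sInf_levySet hy hq)⟩
  refine ⟨⟨x₀, p₀, hx₀, hp₀, (hbest x₀ p₀ hx₀ hp₀).2 hclose, by rw [hd, hopt]⟩, ?_⟩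
  intro x p hx hp
  have hcdf : ∀ j, ell (cdfEReal μ A B) (extPts n x j) (extPts n x (j + 1)) (psum n p j) ≤
      LBB μ A B n ↔
      EllAdm (cdf μ A B) (extPts n x j) (extPts n x (j + 1)) (psum n p j) (LBB μ A B n) :=
    fun j => ell_le_iff hL ⟨1, zero_le_one,
      fun s _ => by linarith [cdf_le_one (μ := μ) (A := A) (B := B) s, psum_nonneg hp.1 j],
      fun s _ => by linarith [cdf_nonneg (μ := μ) (A := A) (B := B) s, psum_le_one hp j]⟩
  have hquant : ∀ j : Fin n, ell (quantEReal μ A B) ((psum n p (j : ℕ) : ℝ) : EReal)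
      ((psum n p ((j : ℕ) + 1) : ℝ) : EReal) (x j) ≤ LBB μ A B n ↔
      EllAdm (quant μ A B) ((psum n p (j : ℕ) : ℝ) : EReal)
        ((psum n p ((j : ℕ) + 1) : ℝ) : EReal) (x j) (LBB μ A B n) := fun j =>
    ell_le_iff hL ⟨B - A, by linarith,
      fun s _ => by linarith [(quant_mem_Icc (μ := μ) hAB.le s).2, (hx.1 j).1],
      fun s _ => by linarith [(quant_mem_Icc (μ := μ) hAB.le s).1, (hx.1 j).2]⟩
  rw [hbest x p hx hp]
  simp only [hcdf, hquant]
  exact ⟨⟨fun h j hj _ => ellAdm_of_atomAdm cdf_nonneg cdf_le_one hp hL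
      (atomAdm_of_levyClose hx hp h) j hj, levyClose_of_ellAdm hx hp⟩,
    ⟨fun h j _ => ellAdm_quant_of_atomAdm hAB.le hx hL (atomAdm_of_levyClose hx hp h) j,
      levyClose_of_ellAdm_quant hAB.le hμ hx hp hL⟩⟩

end BenfordApprox
end
end

section
/- Let b > 1 and n ∈ ℕ. The unique best uniform d_1-approximation of the Benford measure β_b is δ_x^{u_n} with x_j = b^{(2j−1)/(2n)} for j = 1,…,n; in particular its support has exactly n points. Moreover d_1(β_b, δ_x^{u_n}) = (1/log b) · tanh(log b/(4n)), and lim_{n→∞} n · d_1(β_b, δ_x^{u_n}) = 1/4. -/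
open MeasureTheory Filter Set

noncomputable section

namespace BenfordApprox

/-- The midpoint value of a monotone function realizes the half-integral difference. -/
lemma integral_abs_sub_midpoint {f : ℝ → ℝ} (hf : Continuous f) (hmono : Monotone f)
    {s m e : ℝ} (hsm : s < m) (hme : m < e) (hmid : m - s = e - m) :
    ∫ y in s..e, |f y - f m| = (∫ y in m..e, f y) - ∫ y in s..m, f y := by
  have hi : ∀ u v : ℝ, IntervalIntegrable f volume u v := fun u v => hf.intervalIntegrable u v
  have hc : Continuous fun y => |f y - f m| := by fun_prop
  rw [← intervalIntegral.integral_add_adjacent_intervals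
    (hc.intervalIntegrable s m) (hc.intervalIntegrable m e)]
  have hleft : ∫ y in s..m, |f y - f m| = ∫ y in s..m, (f m - f y) := by
    refine intervalIntegral.integral_congr_Ioo_of_le hsm.le fun y hy => ?_
    have := hmono hy.2.le
    rw [abs_of_nonpos (by linarith)]; ring
  have hright : ∫ y in m..e, |f y - f m| = ∫ y in m..e, (f y - f m) := by
    refine intervalIntegral.integral_congr_Ioo_of_le hme.le fun y hy => ?_
    have := hmono hy.1.le
    rw [abs_of_nonneg (by linarith)]
  rw [hleft, hright, intervalIntegral.integral_sub (by simp) (hi _ _),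
    intervalIntegral.integral_sub (hi _ _) (by simp)]
  simp only [intervalIntegral.integral_const, smul_eq_mul]
  rw [hmid]; ring

/-- Every constant other than the midpoint value has a strictly larger mean deviation. -/
lemma lt_integral_abs_sub_of_ne_midpoint {f : ℝ → ℝ} (hf : Continuous f)
    {s m e c : ℝ} (hsm : s < m) (hme : m < e) (hmid : m - s = e - m) (hne : c ≠ f m) :
    (∫ y in m..e, f y) - (∫ y in s..m, f y) < ∫ y in s..e, |f y - c| := by
  have hi : ∀ u v : ℝ, IntervalIntegrable f volume u v := fun u v => hf.intervalIntegrable u v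
  have hc : Continuous fun y => |f y - c| := by fun_prop
  rw [← intervalIntegral.integral_add_adjacent_intervals
    (hc.intervalIntegrable s m) (hc.intervalIntegrable m e)]
  have hle : ∀ y, c - f y ≤ |f y - c| := fun y => by
    rw [abs_sub_comm]; exact le_abs_self _
  have hge : ∀ y, f y - c ≤ |f y - c| := fun y => le_abs_self _
  have hsplit : (∫ y in s..m, (c - f y)) + ∫ y in m..e, (f y - c) =
      (∫ y in m..e, f y) - ∫ y in s..m, f y := by
    rw [intervalIntegral.integral_sub (by simp) (hi _ _),
      intervalIntegral.integral_sub (hi _ _) (by simp)]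
    simp only [intervalIntegral.integral_const, smul_eq_mul]
    rw [hmid]; ring
  rw [← hsplit]
  have hcl : Continuous fun y => c - f y := by fun_prop
  have hcr : Continuous fun y => f y - c := by fun_prop
  rcases lt_or_gt_of_ne hne with h | h
  · refine add_lt_add_of_lt_of_le ?_ (intervalIntegral.integral_mono_on hme.le
      (hcr.intervalIntegrable _ _) (hc.intervalIntegrable _ _) fun y _ => hge y)
    refine intervalIntegral.integral_lt_integral_of_continuousOn_of_le_of_exists_lt hsm
      hcl.continuousOn hc.continuousOn (fun y _ => hle y) ⟨m, right_mem_Icc.2 hsm.le, ?_⟩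
    exact lt_of_lt_of_le (by linarith) (abs_nonneg _)
  · refine add_lt_add_of_le_of_lt (intervalIntegral.integral_mono_on hsm.le
      (hcl.intervalIntegrable _ _) (hc.intervalIntegrable _ _) fun y _ => hle y) ?_
    refine intervalIntegral.integral_lt_integral_of_continuousOn_of_le_of_exists_lt hme
      hcr.continuousOn hc.continuousOn (fun y _ => hge y) ⟨m, left_mem_Icc.2 hme.le, ?_⟩
    exact lt_of_lt_of_le (by linarith) (abs_nonneg _)

lemma integral_const_rpow {b : ℝ} (hb : 1 < b) (u v : ℝ) :
    ∫ y in u..v, b ^ y = (b ^ v - b ^ u) / Real.log b := by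
  have hb0 : 0 < b := by linarith
  have hlog : Real.log b ≠ 0 := (Real.log_pos hb).ne'
  have hderiv : ∀ y ∈ uIcc u v, HasDerivAt (fun y : ℝ => b ^ y / Real.log b) (b ^ y) y := by
    intro y _
    have := ((Real.hasStrictDerivAt_const_rpow hb0 y).hasDerivAt).div_const (Real.log b)
    rwa [mul_div_cancel_right₀ _ hlog] at this
  rw [intervalIntegral.integral_eq_sub_of_hasDerivAt hderiv
    ((Real.continuous_const_rpow hb0.ne').intervalIntegrable _ _)]
  ring

lemma cdf_benford {b : ℝ} (hb : 1 < b) {u : ℝ} (hu : u ∈ Icc (0 : ℝ) 1) :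
    cdf (benford b) 1 b (b ^ u) = u := by
  have hb0 : 0 < b := by linarith
  have hmeas : Measurable fun t : ℝ => b ^ t :=
    (Real.continuous_const_rpow hb0.ne').measurable
  have hset : (fun t : ℝ => b ^ t) ⁻¹' (Icc 1 b ∩ Iic (b ^ u)) = Icc 0 u := by
    ext t
    have h1 : (1 : ℝ) ≤ b ^ t ↔ 0 ≤ t := by
      rw [← Real.rpow_zero b, Real.rpow_le_rpow_left_iff hb]
    have h2 : b ^ t ≤ b ↔ t ≤ 1 := by
      conv_lhs => rw [← Real.rpow_one b, ← Real.rpow_mul hb0.le, one_mul]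
      rw [Real.rpow_le_rpow_left_iff hb]
    simp only [mem_preimage, mem_inter_iff, mem_Icc, mem_Iic, h1, h2,
      Real.rpow_le_rpow_left_iff hb]
    have := hu.2
    constructor
    · rintro ⟨⟨h, -⟩, h'⟩; exact ⟨h, h'⟩
    · rintro ⟨h, h'⟩; exact ⟨⟨h, h'.trans this⟩, h'⟩
  rw [cdf, benford, Measure.map_apply hmeas (measurableSet_Icc.inter measurableSet_Iic), hset,
    restrict_Ico_eq_restrict_Icc, Measure.restrict_apply measurableSet_Icc,
    inter_eq_left.2 (Icc_subset_Icc_right hu.2), Real.volume_Icc, sub_zero,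
    ENNReal.toReal_ofReal hu.1]

lemma benford_singleton_one {b : ℝ} (hb : 1 < b) : benford b {1} = 0 := by
  have hb0 : 0 < b := by linarith
  have hmeas : Measurable fun t : ℝ => b ^ t :=
    (Real.continuous_const_rpow hb0.ne').measurable
  have hset : (fun t : ℝ => b ^ t) ⁻¹' {1} = {0} := by
    ext t
    simp only [mem_preimage, mem_singleton_iff]
    rw [← Real.rpow_zero b, Real.rpow_right_inj hb0 hb.ne']
  rw [benford, Measure.map_apply hmeas (measurableSet_singleton _), hset]
  simp

lemma quant_benford {b : ℝ} (hb : 1 < b) {t : ℝ} (ht : t ∈ Icc (0 : ℝ) 1) :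
    quant (benford b) 1 b t = b ^ t := by
  have hb0 : 0 < b := by linarith
  have hset : {y ∈ Icc 1 b | cdf (benford b) 1 b y ≤ t} = Icc 1 (b ^ t) := by
    have key : ∀ y ∈ Icc 1 b, (cdf (benford b) 1 b y ≤ t ↔ y ≤ b ^ t) := by
      rintro y ⟨h1, h2⟩
      have hy0 : 0 < y := by linarith
      have hy : b ^ Real.logb b y = y := Real.rpow_logb hb0 hb.ne' hy0
      have hmem : Real.logb b y ∈ Icc (0 : ℝ) 1 :=
        ⟨Real.logb_nonneg hb h1, by
          rw [← Real.logb_self_eq_one hb]; exact (Real.logb_le_logb hb hy0 hb0).2 h2⟩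
      have hcdf := cdf_benford hb hmem
      rw [hy] at hcdf
      rw [hcdf, Real.logb_le_iff_le_rpow hb hy0]
    have hbt : b ^ t ≤ b := by
      simpa using (Real.rpow_le_rpow_left_iff hb).2 ht.2
    ext y
    constructor
    · rintro ⟨hy, hle⟩; exact ⟨hy.1, (key y hy).1 hle⟩
    · rintro ⟨h1, h2⟩
      exact ⟨⟨h1, h2.trans hbt⟩, (key y ⟨h1, h2.trans hbt⟩).2 h2⟩
  rw [quant, if_neg, hset, csSup_Icc (Real.one_le_rpow hb.le ht.1)]
  rw [benford_singleton_one hb]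
  simpa using ht.1

lemma discr_unif_toReal {n : ℕ} (x : Fin n → ℝ) {s : Set ℝ} (hs : MeasurableSet s)
    [DecidablePred fun j => x j ∈ s] :
    (discr n x (unif n) s).toReal =
      ((Finset.univ.filter fun j => x j ∈ s).card : ℝ) / n := by
  rw [discr, Measure.finsetSum_apply, ENNReal.toReal_sum]
  · have hterm : ∀ j : Fin n,
        ((ENNReal.ofReal (unif n j) • Measure.dirac (x j) : Measure ℝ) s).toReal =
          if x j ∈ s then 1 / (n : ℝ) else 0 := by
      intro j
      have : (0 : ℝ) ≤ 1 / n := by positivity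
      by_cases h : x j ∈ s
      · simp [Measure.dirac_apply' _ hs, unif, h]
      · simp [Measure.dirac_apply' _ hs, h]
    simp_rw [hterm]
    rw [← Finset.sum_filter, Finset.sum_const, nsmul_eq_mul]
    ring
  · intro j _
    simpa [Measure.dirac_apply' _ hs] using
      ENNReal.mul_ne_top ENNReal.ofReal_ne_top (by by_cases h : x j ∈ s <;> simp [h])

lemma quant_discr_unif {A B : ℝ} {n : ℕ} {x : Fin n → ℝ} (hx : IsXi A B n x) (k : Fin n)
    {t : ℝ} (ht : t ∈ Ico ((k : ℝ) / n) (((k : ℝ) + 1) / n)) :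
    quant (discr n x (unif n)) A B t = x k := by
  classical
  have hn : (0 : ℝ) < n := by exact_mod_cast k.pos
  have ht0 : 0 ≤ t := le_trans (by positivity) ht.1
  have hcard_le : ∀ y < x k, ∀ (p : Fin n → Prop) [DecidablePred p], (∀ j, p j → x j ≤ y) →
      ((Finset.univ.filter p).card : ℝ) / n ≤ t := by
    intro y hy p _ hp
    refine le_trans ?_ ht.1
    gcongr
    have hsub : Finset.univ.filter p ⊆ Finset.Iio k := by
      intro j hj
      rw [Finset.mem_Iio]
      by_contra! h
      exact absurd (hx.2 h) (not_le.2 (((hp j (Finset.mem_filter.1 hj).2)).trans_lt hy))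
    simpa using Finset.card_le_card hsub
  have hcard_gt : ∀ (p : Fin n → Prop) [DecidablePred p], (∀ j ≤ k, p j) →
      t < ((Finset.univ.filter p).card : ℝ) / n := by
    intro p _ hp
    refine ht.2.trans_le ?_
    gcongr
    have hsub : Finset.Iic k ⊆ Finset.univ.filter p := by
      intro j hj
      simpa using hp j (Finset.mem_Iic.1 hj)
    have := Finset.card_le_card hsub
    rw [Fin.card_Iic] at this
    exact_mod_cast this
  rw [quant, discr_unif_toReal x (measurableSet_singleton A)]
  rcases (hx.1 k).1.eq_or_lt with hA | hA
  · rw [if_pos, hA]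
    refine Or.inl (hcard_gt (fun j => x j ∈ ({A} : Set ℝ)) fun j hj => ?_)
    exact le_antisymm (by rw [hA]; exact hx.2 hj) (hx.1 j).1
  · rw [if_neg]
    · have hset : {y ∈ Icc A B | cdf (discr n x (unif n)) A B y ≤ t} = Ico A (x k) := by
        ext y
        simp only [mem_ofPred_eq, cdf,
          discr_unif_toReal x (measurableSet_Icc.inter measurableSet_Iic)]
        constructor
        · rintro ⟨hy, hle⟩
          refine ⟨hy.1, ?_⟩
          by_contra! h
          exact absurd hle (not_le.2 (hcard_gt
            (fun j => x j ∈ Icc A B ∩ Iic y) fun j hj => ⟨hx.1 j, (hx.2 hj).trans h⟩))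
        · rintro ⟨h1, h2⟩
          exact ⟨⟨h1, h2.le.trans (hx.1 k).2⟩,
            hcard_le y h2 (fun j => x j ∈ Icc A B ∩ Iic y) fun j hj => hj.2⟩
      rw [hset, csSup_Ico hA]
    · rw [not_or, not_lt, not_lt]
      exact ⟨hcard_le A hA (fun j => x j ∈ ({A} : Set ℝ)) fun j hj => le_of_eq hj, ht0⟩

/-- The `L¹`-Kantorovich distance decouples into one integral per atom. -/
lemma dKant1_benford_discr_unif {b : ℝ} (hb : 1 < b) {n : ℕ} (hn : 0 < n) {x : Fin n → ℝ}
    (hx : IsXi 1 b n x) :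
    dKant1 1 b (benford b) (discr n x (unif n)) =
      (b - 1)⁻¹ * ∑ k : Fin n, ∫ y in ((k : ℝ) / n)..(((k : ℝ) + 1) / n), |b ^ y - x k| := by
  have hb0 : 0 < b := by linarith
  have hn' : (0 : ℝ) < n := by exact_mod_cast hn
  set F : ℝ → ℝ := fun y => |quant (benford b) 1 b y - quant (discr n x (unif n)) 1 b y| with hF
  have hle : ∀ k : ℕ, (k : ℝ) / n ≤ ((k : ℝ) + 1) / n := fun k => by gcongr; linarith
  have heq : ∀ k : Fin n, EqOn (fun y => |b ^ y - x k|) F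
      (Ioo ((k : ℝ) / n) (((k : ℝ) + 1) / n)) := by
    intro k y hy
    have h0 : (0 : ℝ) ≤ (k : ℝ) / n := by positivity
    have h1 : ((k : ℝ) + 1) / n ≤ 1 := by
      rw [div_le_one hn']; exact_mod_cast k.2
    simp only [hF]
    rw [quant_benford hb ⟨h0.trans hy.1.le, hy.2.le.trans h1⟩,
      quant_discr_unif hx k ⟨hy.1.le, hy.2⟩]
  have hint : ∀ k < n, IntervalIntegrable F volume ((k : ℝ) / n) (((k + 1 : ℕ) : ℝ) / n) := by
    intro k hk
    push_cast
    have hc : Continuous fun y : ℝ => |b ^ y - x ⟨k, hk⟩| :=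
      ((Real.continuous_const_rpow hb0.ne').sub continuous_const).abs
    refine (hc.intervalIntegrable _ _).congr_uIoo ?_
    rw [uIoo_of_le (hle k)]
    exact heq ⟨k, hk⟩
  have hsum := intervalIntegral.sum_integral_adjacent_intervals
    (a := fun k : ℕ => (k : ℝ) / n) hint
  rw [dKant1, ← integral_Ioc_eq_integral_Ioo, ← intervalIntegral.integral_of_le zero_le_one]
  simp only [Nat.cast_zero, zero_div, div_self hn'.ne'] at hsum
  rw [← hsum, Finset.sum_range]
  congr 1
  refine Finset.sum_congr rfl fun k _ => ?_
  push_cast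
  exact (intervalIntegral.integral_congr_Ioo_of_le (hle k) (heq k)).symm

lemma isXi_benford_midpoints {b : ℝ} (hb : 1 < b) {n : ℕ} :
    IsXi 1 b n (fun j : Fin n => b ^ ((2 * (j : ℝ) + 1) / (2 * (n : ℝ)))) := by
  refine ⟨fun j => ⟨Real.one_le_rpow hb.le (by positivity), ?_⟩, fun i j hij => ?_⟩
  · have hn : (0 : ℝ) < n := by exact_mod_cast j.pos
    have hj : (j : ℝ) + 1 ≤ n := by exact_mod_cast j.2
    conv_rhs => rw [← Real.rpow_one b]
    refine Real.rpow_le_rpow_of_exponent_le hb.le ?_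
    rw [div_le_one (by positivity)]
    linarith
  · have : (i : ℝ) ≤ j := by exact_mod_cast hij
    refine Real.rpow_le_rpow_of_exponent_le hb.le ?_
    gcongr

lemma dKant1_benford_midpoints {b : ℝ} (hb : 1 < b) {n : ℕ} (hn : 0 < n) :
    dKant1 1 b (benford b)
        (discr n (fun j : Fin n => b ^ ((2 * (j : ℝ) + 1) / (2 * (n : ℝ)))) (unif n)) =
      1 / Real.log b * Real.tanh (Real.log b / (4 * (n : ℝ))) := by
  have hb0 : 0 < b := by linarith
  have hn' : (0 : ℝ) < n := by exact_mod_cast hn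
  have hlog : 0 < Real.log b := Real.log_pos hb
  set q : ℝ := b ^ (1 / (2 * (n : ℝ))) with hq
  have hq1 : 1 < q := Real.one_lt_rpow hb (by positivity)
  have hpow : ∀ i : ℕ, b ^ ((i : ℝ) / (2 * n)) = q ^ i := by
    intro i
    rw [hq, ← Real.rpow_natCast, ← Real.rpow_mul hb0.le]
    congr 1; ring
  have hqn : (q ^ 2) ^ n = b := by
    rw [← pow_mul, ← hpow]
    push_cast
    rw [div_self (by positivity), Real.rpow_one]
  rw [dKant1_benford_discr_unif hb hn (isXi_benford_midpoints hb)]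
  have hterm : ∀ k : Fin n,
      ∫ y in ((k : ℝ) / n)..(((k : ℝ) + 1) / n), |b ^ y - b ^ ((2 * (k : ℝ) + 1) / (2 * (n : ℝ)))|
        = (q - 1) ^ 2 / Real.log b * (q ^ 2) ^ (k : ℕ) := by
    intro k
    have hs : (k : ℝ) / n = ((2 * k : ℕ) : ℝ) / (2 * n) := by push_cast; field_simp
    have hm : (2 * (k : ℝ) + 1) / (2 * n) = ((2 * k + 1 : ℕ) : ℝ) / (2 * n) := by push_cast; rfl
    have he : ((k : ℝ) + 1) / n = ((2 * k + 2 : ℕ) : ℝ) / (2 * n) := by push_cast; field_simp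
    rw [integral_abs_sub_midpoint (f := fun y : ℝ => b ^ y)
      (Real.continuous_const_rpow hb0.ne') (Real.monotone_rpow_of_base_ge_one hb.le),
      integral_const_rpow hb, integral_const_rpow hb, hs, hm, he, hpow, hpow, hpow]
    · ring
    · field_simp; linarith
    · field_simp; linarith
    · field_simp; ring
  rw [Finset.sum_congr rfl fun k _ => hterm k, ← Finset.mul_sum,
    ← Finset.sum_range (fun k => (q ^ 2) ^ k), geom_sum_eq (by nlinarith), hqn]
  have hexp : Real.exp (Real.log b / (4 * n)) ^ 2 = q := by
    rw [hq, Real.rpow_def_of_pos hb0, ← Real.exp_nat_mul]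
    congr 1; push_cast; ring
  rw [Real.tanh_eq, Real.exp_neg]
  set r := Real.exp (Real.log b / (4 * n))
  have hr0 : 0 < r := Real.exp_pos _
  have htanh : (r - r⁻¹) / (r + r⁻¹) = (q - 1) / (q + 1) := by
    rw [← hexp]; field_simp
  have h1 : b - 1 ≠ 0 := by linarith
  have h2 : q - 1 ≠ 0 := by linarith
  have h3 : q + 1 ≠ 0 := by linarith
  have h4 : q ^ 2 - 1 = (q - 1) * (q + 1) := by ring
  rw [htanh, h4]
  field_simp

lemma dKant1_benford_midpoints_lt {b : ℝ} (hb : 1 < b) {n : ℕ} (hn : 0 < n) {y : Fin n → ℝ}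
    (hy : IsXi 1 b n y) (hne : y ≠ fun j : Fin n => b ^ ((2 * (j : ℝ) + 1) / (2 * (n : ℝ)))) :
    dKant1 1 b (benford b)
        (discr n (fun j : Fin n => b ^ ((2 * (j : ℝ) + 1) / (2 * (n : ℝ)))) (unif n)) <
      dKant1 1 b (benford b) (discr n y (unif n)) := by
  have hb0 : 0 < b := by linarith
  have hn' : (0 : ℝ) < n := by exact_mod_cast hn
  rw [dKant1_benford_discr_unif hb hn (isXi_benford_midpoints hb),
    dKant1_benford_discr_unif hb hn hy]
  have hcell : ∀ k : Fin n, y k ≠ b ^ ((2 * (k : ℝ) + 1) / (2 * (n : ℝ))) →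
      ∫ t in ((k : ℝ) / n)..(((k : ℝ) + 1) / n), |b ^ t - b ^ ((2 * (k : ℝ) + 1) / (2 * (n : ℝ)))|
        < ∫ t in ((k : ℝ) / n)..(((k : ℝ) + 1) / n), |b ^ t - y k| := by
    intro k hk
    have hsm : (k : ℝ) / n < (2 * (k : ℝ) + 1) / (2 * n) := by field_simp; linarith
    have hme : (2 * (k : ℝ) + 1) / (2 * n) < ((k : ℝ) + 1) / n := by field_simp; linarith
    have hmid : (2 * (k : ℝ) + 1) / (2 * n) - (k : ℝ) / n =
        ((k : ℝ) + 1) / n - (2 * (k : ℝ) + 1) / (2 * n) := by field_simp; ring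
    have hcont := Real.continuous_const_rpow hb0.ne'
    rw [integral_abs_sub_midpoint (f := fun y : ℝ => b ^ y) hcont
      (Real.monotone_rpow_of_base_ge_one hb.le) hsm hme hmid]
    exact lt_integral_abs_sub_of_ne_midpoint hcont hsm hme hmid hk
  obtain ⟨j, hj⟩ := Function.ne_iff.1 hne
  refine mul_lt_mul_of_pos_left ?_ (inv_pos.2 (by linarith))
  refine Finset.sum_lt_sum (fun k _ => ?_) ⟨j, Finset.mem_univ j, hcell j hj⟩
  by_cases hk : y k = b ^ ((2 * (k : ℝ) + 1) / (2 * (n : ℝ)))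
  · rw [hk]
  · exact (hcell k hk).le

lemma tendsto_nat_mul_tanh_div (c : ℝ) :
    Tendsto (fun m : ℕ => (m : ℝ) * Real.tanh (c / m)) atTop (nhds c) := by
  have hderiv : HasDerivAt (fun h : ℝ => Real.tanh (c * h)) c 0 := by
    have hlin : HasDerivAt (fun h : ℝ => c * h) c 0 := by
      simpa using (hasDerivAt_id (0 : ℝ)).const_mul c
    have := hlin.sinh.div hlin.cosh (Real.cosh_pos _).ne'
    simp only [Real.tanh_eq_sinh_div_cosh]
    simpa [Pi.div_def] using this
  have hslope := hasDerivAt_iff_tendsto_slope_zero.1 hderiv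
  have hinv : Tendsto (fun m : ℕ => (m : ℝ)⁻¹) atTop (nhdsWithin 0 {0}ᶜ) := by
    refine tendsto_nhdsWithin_iff.2 ⟨tendsto_inv_atTop_nhds_zero_nat, ?_⟩
    filter_upwards [eventually_gt_atTop 0] with m hm
    simpa using hm.ne'
  refine (hslope.comp hinv).congr fun m => ?_
  simp [div_eq_mul_inv]

/-- Cor. 4.2: the unique best uniform `d_1`-approximation of the Benford
measure `β_b` has atoms `x_j = b^{(2j−1)/(2n)}`, with the stated distance and
uniform quantization coefficient `1/4`. -/
theorem best_uniform_dKant1_benford (b : ℝ) (hb : 1 < b) (n : ℕ) (hn : 0 < n) :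
    IsXi 1 b n (fun j : Fin n => b ^ ((2 * (j : ℝ) + 1) / (2 * (n : ℝ)))) ∧
    (∀ y : Fin n → ℝ, IsXi 1 b n y →
      dKant1 1 b (benford b)
          (discr n (fun j : Fin n => b ^ ((2 * (j : ℝ) + 1) / (2 * (n : ℝ)))) (unif n)) ≤
        dKant1 1 b (benford b) (discr n y (unif n))) ∧
    (∀ y : Fin n → ℝ, IsXi 1 b n y →
      (∀ z : Fin n → ℝ, IsXi 1 b n z →
        dKant1 1 b (benford b) (discr n y (unif n)) ≤
          dKant1 1 b (benford b) (discr n z (unif n))) →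
      discr n y (unif n) =
        discr n (fun j : Fin n => b ^ ((2 * (j : ℝ) + 1) / (2 * (n : ℝ)))) (unif n)) ∧
    (Set.range (fun j : Fin n => b ^ ((2 * (j : ℝ) + 1) / (2 * (n : ℝ))))).ncard = n ∧
    dKant1 1 b (benford b)
        (discr n (fun j : Fin n => b ^ ((2 * (j : ℝ) + 1) / (2 * (n : ℝ)))) (unif n)) =
      1 / Real.log b * Real.tanh (Real.log b / (4 * (n : ℝ))) ∧
    Filter.Tendsto
      (fun m : ℕ => (m : ℝ) * dKant1 1 b (benford b)
        (discr m (fun j : Fin m => b ^ ((2 * (j : ℝ) + 1) / (2 * (m : ℝ)))) (unif m)))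
      Filter.atTop (nhds (1 / 4)) := by
  have hb0 : 0 < b := by linarith
  have hn' : (0 : ℝ) < n := by exact_mod_cast hn
  refine ⟨isXi_benford_midpoints hb, fun y hy => ?_, fun y hy hmin => ?_, ?_,
    dKant1_benford_midpoints hb hn, ?_⟩
  · by_cases h : y = fun j : Fin n => b ^ ((2 * (j : ℝ) + 1) / (2 * (n : ℝ)))
    · rw [h]
    · exact (dKant1_benford_midpoints_lt hb hn hy h).le
  · by_contra h
    have hne : y ≠ fun j : Fin n => b ^ ((2 * (j : ℝ) + 1) / (2 * (n : ℝ))) :=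
      fun hy' => h (by rw [hy'])
    exact absurd (hmin _ (isXi_benford_midpoints hb))
      (not_le.2 (dKant1_benford_midpoints_lt hb hn hy hne))
  · have hinj : Function.Injective
        fun j : Fin n => b ^ ((2 * (j : ℝ) + 1) / (2 * (n : ℝ))) := by
      intro i j hij
      have := (Real.rpow_right_inj hb0 hb.ne').1 hij
      rw [div_left_inj' (by positivity)] at this
      have : (i : ℝ) = j := by linarith
      exact Fin.ext (by exact_mod_cast this)
    rw [← Set.image_univ, Set.ncard_image_of_injective _ hinj, Set.ncard_univ, Nat.card_fin]
  · have hlog : Real.log b ≠ 0 := (Real.log_pos hb).ne'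
    have hlim := (tendsto_nat_mul_tanh_div (Real.log b / 4)).const_mul (1 / Real.log b)
    have hval : 1 / Real.log b * (Real.log b / 4) = 1 / 4 := by field_simp
    rw [hval] at hlim
    refine hlim.congr' ?_
    filter_upwards [eventually_gt_atTop 0] with m hm
    rw [dKant1_benford_midpoints hb hm, div_div]
    ring

end BenfordApprox
end
end
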